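/- Let X ∈ ℝ^{m×m} be symmetric, let a₂, ε₂ > 0, and let L₂ ≥ 1/a₂. Define f(U,V) := (1/2)‖X − U V Uᵀ‖² and h₂(U,V) := (a₂/2)(‖U‖⁴ + ε₂)‖V‖² (Frobenius norms). Then for every fixed U ∈ ℝ^{m×r}, the function V ↦ L₂·h₂(U,V) − f(U,V) is convex on ℝ^{r×r}. -/

import Mathlib

open Matrix

/-- The Frobenius norm `‖A‖ = √(trace (Aᵀ A))`. -/
noncomputable def fnorm {m r : ℕ} (A : Matrix (Fin m) (Fin r) ℝ) : ℝ :=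
  Real.sqrt (Aᵀ * A).trace

theorem fnorm_sq_eq_trace {m r : ℕ} (A : Matrix (Fin m) (Fin r) ℝ) :
    fnorm A ^ 2 = (Aᵀ * A).trace := by
  rw [fnorm, Real.sq_sqrt]
  simp only [trace, diag_apply, mul_apply, transpose_apply]
  exact Finset.sum_nonneg fun _ _ => Finset.sum_nonneg fun _ _ => mul_self_nonneg _

section

attribute [local instance] Matrix.frobeniusNormedAddCommGroup

theorem fnorm_eq_frobenius_norm {m r : ℕ} (A : Matrix (Fin m) (Fin r) ℝ) : fnorm A = ‖A‖ := by
  rw [fnorm, frobenius_norm_def, Real.sqrt_eq_rpow, Finset.sum_comm]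
  simp [trace, mul_apply, pow_two]

theorem fnorm_mul_le {l m n : ℕ} (A : Matrix (Fin l) (Fin m) ℝ) (B : Matrix (Fin m) (Fin n) ℝ) :
    fnorm (A * B) ≤ fnorm A * fnorm B := by
  simpa only [fnorm_eq_frobenius_norm] using frobenius_norm_mul A B

theorem fnorm_transpose {m r : ℕ} (A : Matrix (Fin m) (Fin r) ℝ) : fnorm Aᵀ = fnorm A := by
  simpa only [fnorm_eq_frobenius_norm] using frobenius_norm_transpose A

end

theorem fnorm_nonneg {m r : ℕ} (A : Matrix (Fin m) (Fin r) ℝ) : 0 ≤ fnorm A :=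
  Real.sqrt_nonneg _

theorem fnorm_congruence_sq_le {m r : ℕ} (U : Matrix (Fin m) (Fin r) ℝ)
    (W : Matrix (Fin r) (Fin r) ℝ) : fnorm (U * W * Uᵀ) ^ 2 ≤ fnorm U ^ 4 * fnorm W ^ 2 := by
  have h : fnorm (U * W * Uᵀ) ≤ fnorm U * fnorm W * fnorm U :=
    calc fnorm (U * W * Uᵀ) ≤ fnorm (U * W) * fnorm Uᵀ := fnorm_mul_le _ _
      _ ≤ fnorm U * fnorm W * fnorm U := by
        rw [fnorm_transpose]
        exact mul_le_mul_of_nonneg_right (fnorm_mul_le _ _) (fnorm_nonneg U)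
  calc fnorm (U * W * Uᵀ) ^ 2 ≤ (fnorm U * fnorm W * fnorm U) ^ 2 :=
        pow_le_pow_left₀ (fnorm_nonneg _) h 2
    _ = fnorm U ^ 4 * fnorm W ^ 2 := by ring

theorem fnorm_sq_convex_combination {m r : ℕ} (P Q : Matrix (Fin m) (Fin r) ℝ) {a b : ℝ}
    (hab : a + b = 1) :
    fnorm (a • P + b • Q) ^ 2 =
      a * fnorm P ^ 2 + b * fnorm Q ^ 2 - a * b * fnorm (P - Q) ^ 2 := by
  obtain rfl : b = 1 - a := by linarith
  simp only [fnorm_sq_eq_trace, transpose_add, transpose_sub, transpose_smul, Matrix.add_mul,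
    Matrix.mul_add, Matrix.sub_mul, Matrix.mul_sub, Matrix.smul_mul, Matrix.mul_smul, trace_add, trace_sub,
    trace_smul, smul_eq_mul]
  ring

/-- Block relative smoothness of the SymTriNMF objective in the `V`-block:
`V ↦ L₂·h₂(U,V) − f(U,V)` is convex, where `f(U,V) = (1/2)‖X − U V Uᵀ‖²` and
`h₂(U,V) = (a₂/2)(‖U‖⁴ + ε₂)‖V‖²`. -/
theorem symTriNMF_block_relative_smooth_V {m r : ℕ}
    (X : Matrix (Fin m) (Fin m) ℝ) (hX : X.IsSymm)
    (a₂ ε₂ L₂ : ℝ) (ha₂ : 0 < a₂) (hε₂ : 0 < ε₂) (hL₂ : 1 / a₂ ≤ L₂)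
    (U : Matrix (Fin m) (Fin r) ℝ) :
    ConvexOn ℝ Set.univ (fun V : Matrix (Fin r) (Fin r) ℝ =>
      L₂ * (a₂ / 2 * (fnorm U ^ 4 + ε₂) * fnorm V ^ 2)
        - 1 / 2 * fnorm (X - U * V * Uᵀ) ^ 2) := by
  refine ⟨convex_univ, fun V _ W _ a b ha hb hab => ?_⟩
  have hcomb : X - U * (a • V + b • W) * Uᵀ =
      a • (X - U * V * Uᵀ) + b • (X - U * W * Uᵀ) := by
    obtain rfl : b = 1 - a := by linarith
    simp only [Matrix.mul_add, Matrix.add_mul, Matrix.mul_smul, Matrix.smul_mul]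
    module
  have hdiff : fnorm ((X - U * V * Uᵀ) - (X - U * W * Uᵀ)) ^ 2 ≤
      fnorm U ^ 4 * fnorm (V - W) ^ 2 := by
    have h : (X - U * V * Uᵀ) - (X - U * W * Uᵀ) = U * (W - V) * Uᵀ := by
      rw [Matrix.mul_sub, Matrix.sub_mul]; abel
    have hVW : fnorm (V - W) = fnorm (W - V) := by
      rw [← neg_sub W V, fnorm, fnorm, transpose_neg, neg_mul_neg]
    rw [h, hVW]
    exact fnorm_congruence_sq_le U (W - V)
  have hLa : 1 ≤ L₂ * a₂ := (div_le_iff₀ ha₂).1 hL₂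
  have hcoef : fnorm U ^ 4 * fnorm (V - W) ^ 2 ≤
      L₂ * a₂ * ((fnorm U ^ 4 + ε₂) * fnorm (V - W) ^ 2) :=
    calc fnorm U ^ 4 * fnorm (V - W) ^ 2 ≤ (fnorm U ^ 4 + ε₂) * fnorm (V - W) ^ 2 := by
          gcongr; linarith
      _ ≤ L₂ * a₂ * ((fnorm U ^ 4 + ε₂) * fnorm (V - W) ^ 2) :=
          le_mul_of_one_le_left (by positivity) hLa
  have hgap := mul_le_mul_of_nonneg_left (hdiff.trans hcoef) (mul_nonneg ha hb)
  simp only [smul_eq_mul]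
  rw [hcomb, fnorm_sq_convex_combination _ _ hab, fnorm_sq_convex_combination _ _ hab]
  linarith
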